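/- (Weighted multilinear fractional integral form of the Pitt inequality.) Let m,n ≥ 1, 0 < α_k < n, α = Σ α_k with (m−1)n < α < mn, and β = α − (m−1)n. Then for every nonnegative measurable function f on (ℝ^n)^m, ∫_{ℝ^n} |x|^{−β} · (∫_{(ℝ^n)^m} Π_{k=1}^m |x−y_k|^{−(n−α_k/2)} f(y_1,…,y_m) dy)² dx ≤ D_β · ∫_{(ℝ^n)^m} f(y)² dy, where D_β = π^{(m+1)n/2} · Π_{k=1}^m [Γ(α_k/4)² Γ((n−α_k)/2) / (Γ((2n−α_k)/4)² Γ(α_k/2))] · [Γ(β/2)/Γ((n−β)/2)] · [Γ((n−β)/4)/Γ((n+β)/4)]². -/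

import Mathlib

open MeasureTheory Real
open scoped ENNReal

noncomputable section

theorem lintegral_rpow_mul_exp_neg_mul_Ioi {p r : ℝ} (hp : 0 < p) (hr : 0 < r) :
    ∫⁻ t in Set.Ioi (0 : ℝ), ENNReal.ofReal (t ^ (p - 1) * exp (-(r * t))) =
      ENNReal.ofReal ((1 / r) ^ p * Gamma p) := by
  rw [← integral_rpow_mul_exp_neg_mul_Ioi hp hr, ofReal_integral_eq_lintegral_ofReal]
  · have h := integrableOn_rpow_mul_exp_neg_mul_rpow (s := p - 1) (by linarith) one_pos hr
    simpa only [rpow_one, neg_mul, IntegrableOn] using h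
  · filter_upwards [self_mem_ae_restrict measurableSet_Ioi] with t ht
    have := Set.mem_Ioi.1 ht
    positivity

theorem lintegral_Ioi_comp_mul_left (g : ℝ → ℝ≥0∞) {s : ℝ} (hs : 0 < s) :
    ∫⁻ t in Set.Ioi (0 : ℝ), g t = ∫⁻ v in Set.Ioi (0 : ℝ), ENNReal.ofReal s * g (s * v) := by
  have himage : (fun v : ℝ => s * v) '' Set.Ioi 0 = Set.Ioi 0 := by
    rw [Set.image_mul_left_Ioi hs, mul_zero]
  conv_lhs => rw [← himage]
  rw [lintegral_image_eq_lintegral_abs_deriv_mul (f' := fun _ => s) measurableSet_Ioi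
    (fun v _ => by simpa using ((hasDerivAt_id v).const_mul s).hasDerivWithinAt)
    (mul_right_injective₀ hs.ne').injOn, abs_of_pos hs]

theorem lintegral_rpow_mul_one_add_rpow_Ioi {a b : ℝ} (ha : 0 < a) (hb : 0 < b) :
    ∫⁻ v in Set.Ioi (0 : ℝ), ENNReal.ofReal (v ^ (a - 1) * (1 + v) ^ (-(a + b))) =
      ENNReal.ofReal (Gamma a * Gamma b / Gamma (a + b)) := by
  have hab : 0 < Gamma (a + b) := Gamma_pos_of_pos (add_pos ha hb)
  have key : ∫⁻ v in Set.Ioi (0 : ℝ),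
      ENNReal.ofReal (Gamma (a + b)) * ENNReal.ofReal (v ^ (a - 1) * (1 + v) ^ (-(a + b))) =
      ENNReal.ofReal (Gamma a * Gamma b) := by
    calc _ = ∫⁻ v in Set.Ioi (0 : ℝ), ∫⁻ t in Set.Ioi (0 : ℝ),
          ENNReal.ofReal (v ^ (a - 1)) *
            ENNReal.ofReal (t ^ (a + b - 1) * exp (-((1 + v) * t))) := by
          refine setLIntegral_congr_fun measurableSet_Ioi fun v hv => ?_
          have hv : 0 < v := hv
          have h1v : 0 < 1 + v := by linarith
          rw [lintegral_const_mul _ (by fun_prop),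
            lintegral_rpow_mul_exp_neg_mul_Ioi (add_pos ha hb) h1v,
            ← ENNReal.ofReal_mul hab.le, ← ENNReal.ofReal_mul (by positivity),
            one_div, inv_rpow h1v.le, ← rpow_neg h1v.le]
          ring_nf
      _ = ∫⁻ t in Set.Ioi (0 : ℝ), ∫⁻ v in Set.Ioi (0 : ℝ),
          ENNReal.ofReal (v ^ (a - 1)) *
            ENNReal.ofReal (t ^ (a + b - 1) * exp (-((1 + v) * t))) := by
          refine lintegral_lintegral_swap (Measurable.aemeasurable ?_)
          unfold Function.uncurry
          fun_prop
      _ = ∫⁻ t in Set.Ioi (0 : ℝ),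
          ENNReal.ofReal (Gamma a) * ENNReal.ofReal (t ^ (b - 1) * exp (-(1 * t))) := by
          refine setLIntegral_congr_fun measurableSet_Ioi fun t ht => ?_
          have ht : 0 < t := ht
          have hcongr : ∫⁻ v in Set.Ioi (0 : ℝ), ENNReal.ofReal (v ^ (a - 1)) *
              ENNReal.ofReal (t ^ (a + b - 1) * exp (-((1 + v) * t))) =
              ∫⁻ v in Set.Ioi (0 : ℝ), ENNReal.ofReal (t ^ (a + b - 1) * exp (-t)) *
                ENNReal.ofReal (v ^ (a - 1) * exp (-(t * v))) := by
            refine setLIntegral_congr_fun measurableSet_Ioi fun v hv => ?_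
            have hv : 0 < v := hv
            rw [← ENNReal.ofReal_mul (by positivity), ← ENNReal.ofReal_mul (by positivity),
              show -((1 + v) * t) = -t + -(t * v) by ring, exp_add]
            ring_nf
          rw [hcongr, lintegral_const_mul _ (by fun_prop),
            lintegral_rpow_mul_exp_neg_mul_Ioi ha ht,
            ← ENNReal.ofReal_mul (by positivity),
            ← ENNReal.ofReal_mul (Gamma_pos_of_pos ha).le, one_div, inv_rpow ht.le,
            ← rpow_neg ht.le, show a + b - 1 = (b - 1) + a by ring, rpow_add ht, one_mul,
            rpow_neg ht.le]
          congr 1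
          field_simp
      _ = ENNReal.ofReal (Gamma a * Gamma b) := by
          rw [lintegral_const_mul _ (by fun_prop),
            lintegral_rpow_mul_exp_neg_mul_Ioi hb one_pos,
            ← ENNReal.ofReal_mul (Gamma_pos_of_pos ha).le]
          simp
  rw [lintegral_const_mul _ (by fun_prop)] at key
  rw [ENNReal.ofReal_div_of_pos hab, ← key, mul_comm]
  exact (ENNReal.mul_div_cancel_right (by simpa using hab) ENNReal.ofReal_ne_top).symm

theorem lintegral_lintegral_rpow_mul_gaussian {p q d r : ℝ} (hp : p < d / 2) (hq : q < d / 2)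
    (hpq : d / 2 < p + q) (hr : 0 < r) :
    ∫⁻ s in Set.Ioi (0 : ℝ), ∫⁻ t in Set.Ioi (0 : ℝ),
        ENNReal.ofReal (s ^ (p - 1) * t ^ (q - 1)) *
        ENNReal.ofReal ((π / (s + t)) ^ (d / 2) * exp (-(s * t / (s + t) * r ^ 2))) =
      ENNReal.ofReal (π ^ (d / 2) * Gamma (p + q - d / 2) *
        (Gamma (d / 2 - p) * Gamma (d / 2 - q) / Gamma (d - p - q)) *
        r ^ (d - 2 * p - 2 * q)) := by
  have hΓ : 0 < Gamma (p + q - d / 2) := Gamma_pos_of_pos (by linarith)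
  calc _ = ∫⁻ s in Set.Ioi (0 : ℝ), ∫⁻ v in Set.Ioi (0 : ℝ),
        ENNReal.ofReal (π ^ (d / 2) * v ^ (q - 1) * (1 + v) ^ (-(d / 2))) *
        ENNReal.ofReal (s ^ (p + q - d / 2 - 1) * exp (-((v / (1 + v) * r ^ 2) * s))) := by
        refine setLIntegral_congr_fun measurableSet_Ioi fun s hs => ?_
        have hs : 0 < s := hs
        rw [lintegral_Ioi_comp_mul_left _ hs]
        refine setLIntegral_congr_fun measurableSet_Ioi fun v hv => ?_
        have hv : 0 < v := hv
        have h1v : 0 < 1 + v := by linarith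
        rw [← ENNReal.ofReal_mul (by positivity), ← ENNReal.ofReal_mul (by positivity),
          ← ENNReal.ofReal_mul (by positivity)]
        congr 1
        have he : s * (s * v) / (s + s * v) * r ^ 2 = v / (1 + v) * r ^ 2 * s := by
          field_simp
        rw [he, show s + s * v = s * (1 + v) by ring, div_rpow pi_pos.le (by positivity),
          mul_rpow hs.le h1v.le, mul_rpow hs.le hv.le, rpow_neg h1v.le,
          show p + q - d / 2 - 1 = (p - 1) + (q - 1) + 1 - d / 2 by ring,
          rpow_sub hs _ (d / 2), rpow_add_one hs.ne', rpow_add hs]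
        field_simp
    _ = ∫⁻ v in Set.Ioi (0 : ℝ), ∫⁻ s in Set.Ioi (0 : ℝ),
        ENNReal.ofReal (π ^ (d / 2) * v ^ (q - 1) * (1 + v) ^ (-(d / 2))) *
        ENNReal.ofReal (s ^ (p + q - d / 2 - 1) * exp (-((v / (1 + v) * r ^ 2) * s))) := by
        refine lintegral_lintegral_swap (Measurable.aemeasurable ?_)
        unfold Function.uncurry
        fun_prop
    _ = ∫⁻ v in Set.Ioi (0 : ℝ),
        ENNReal.ofReal (π ^ (d / 2) * Gamma (p + q - d / 2) * r ^ (d - 2 * p - 2 * q)) *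
        ENNReal.ofReal (v ^ ((d / 2 - p) - 1) *
          (1 + v) ^ (-((d / 2 - p) + (d / 2 - q)))) := by
        refine setLIntegral_congr_fun measurableSet_Ioi fun v hv => ?_
        have hv : 0 < v := hv
        have h1v : 0 < 1 + v := by linarith
        rw [lintegral_const_mul _ (by fun_prop),
          lintegral_rpow_mul_exp_neg_mul_Ioi (by linarith) (by positivity),
          ← ENNReal.ofReal_mul (by positivity), ← ENNReal.ofReal_mul (by positivity)]
        congr 1
        have hrpow : (r ^ 2) ^ (p + q - d / 2) = (r ^ (d - 2 * p - 2 * q))⁻¹ := by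
          rw [← rpow_natCast, ← rpow_mul hr.le, ← rpow_neg hr.le]
          push_cast
          ring_nf
        rw [one_div, inv_rpow (by positivity), mul_rpow (by positivity) (by positivity), hrpow,
          div_rpow hv.le h1v.le,
          show d / 2 - p - 1 = (q - 1) - (p + q - d / 2) by ring, rpow_sub hv (q - 1),
          show -(d / 2 - p + (d / 2 - q)) = -(d / 2) + (p + q - d / 2) by ring, rpow_add h1v]
        field_simp
    _ = _ := by
        rw [lintegral_const_mul _ (by fun_prop),
          lintegral_rpow_mul_one_add_rpow_Ioi (by linarith) (by linarith),
          ← ENNReal.ofReal_mul (by positivity)]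
        congr 1
        rw [show d / 2 - p + (d / 2 - q) = d - p - q by ring]
        ring

/-- The norm power as a superposition of Gaussians. -/
theorem ofReal_Gamma_mul_norm_rpow {V : Type*} [NormedAddCommGroup V] {p : ℝ}
    (hp : 0 < p) {y : V} (hy : y ≠ 0) :
    ENNReal.ofReal (Gamma p) * ENNReal.ofReal (‖y‖ ^ (-(2 * p))) =
      ∫⁻ t in Set.Ioi (0 : ℝ), ENNReal.ofReal (t ^ (p - 1) * exp (-(t * ‖y‖ ^ 2))) := by
  have hy : 0 < ‖y‖ := norm_pos_iff.2 hy
  simp_rw [mul_comm _ (‖y‖ ^ 2)]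
  rw [lintegral_rpow_mul_exp_neg_mul_Ioi hp (by positivity),
    ← ENNReal.ofReal_mul (Gamma_pos_of_pos hp).le, one_div, inv_rpow (by positivity),
    ← rpow_natCast, ← rpow_mul hy.le, rpow_neg hy.le, mul_comm]
  norm_num

theorem mul_sq_norm_sub_add_mul_sq_norm {V : Type*} [NormedAddCommGroup V]
    [InnerProductSpace ℝ V] (x y : V) {s t : ℝ} (hst : s + t ≠ 0) :
    s * ‖x - y‖ ^ 2 + t * ‖y‖ ^ 2 =
      (s + t) * ‖y - (s / (s + t)) • x‖ ^ 2 + s * t / (s + t) * ‖x‖ ^ 2 := by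
  rw [norm_sub_sq_real, norm_sub_sq_real, inner_smul_right, norm_smul, mul_pow, norm_eq_abs,
    sq_abs, real_inner_comm]
  field_simp
  ring

section InnerProductSpace

variable {V : Type*} [NormedAddCommGroup V] [InnerProductSpace ℝ V] [FiniteDimensional ℝ V]
  [MeasurableSpace V] [BorelSpace V]

theorem lintegral_exp_neg_mul_sq_norm {b : ℝ} (hb : 0 < b) :
    ∫⁻ y : V, ENNReal.ofReal (exp (-b * ‖y‖ ^ 2)) =
      ENNReal.ofReal ((π / b) ^ (Module.finrank ℝ V / 2 : ℝ)) := by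
  rw [← GaussianFourier.integral_rexp_neg_mul_sq_norm hb, ofReal_integral_eq_lintegral_ofReal]
  · have h := (GaussianFourier.integrable_cexp_neg_mul_sq_norm_add (b := (b : ℂ))
      (by simpa using hb) 0 (0 : V)).re
    convert h using 2 with y
    have : (-(b : ℂ) * (‖y‖ : ℂ) ^ 2 + 0 * (inner ℝ (0 : V) y : ℝ)) =
      ((-b * ‖y‖ ^ 2 : ℝ) : ℂ) := by push_cast; ring
    rw [this, ← Complex.ofReal_exp]
    rfl
  · exact Filter.Eventually.of_forall fun y => (exp_pos _).le

theorem lintegral_exp_neg_mul_sq_norm_sub_add (x : V) {s t : ℝ} (hs : 0 < s) (ht : 0 < t) :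
    ∫⁻ y : V, ENNReal.ofReal (exp (-(s * ‖x - y‖ ^ 2 + t * ‖y‖ ^ 2))) =
      ENNReal.ofReal ((π / (s + t)) ^ (Module.finrank ℝ V / 2 : ℝ) *
        exp (-(s * t / (s + t) * ‖x‖ ^ 2))) := by
  have hst : 0 < s + t := add_pos hs ht
  calc _ = ∫⁻ y : V, ENNReal.ofReal (exp (-(s + t) * ‖y - (s / (s + t)) • x‖ ^ 2)) *
        ENNReal.ofReal (exp (-(s * t / (s + t) * ‖x‖ ^ 2))) := by
        refine lintegral_congr fun y => ?_
        rw [← ENNReal.ofReal_mul (exp_pos _).le, ← exp_add,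
          mul_sq_norm_sub_add_mul_sq_norm x y hst.ne']
        ring_nf
    _ = _ := by
        rw [lintegral_mul_const _ (by fun_prop),
          lintegral_sub_right_eq_self
            (fun y : V => ENNReal.ofReal (exp (-(s + t) * ‖y‖ ^ 2))),
          lintegral_exp_neg_mul_sq_norm hst, ← ENNReal.ofReal_mul (by positivity)]

theorem lintegral_norm_sub_rpow_mul_norm_rpow [Nontrivial V] {p q : ℝ}
    (hp0 : 0 < p) (hq0 : 0 < q)
    (hp : p < Module.finrank ℝ V / 2) (hq : q < Module.finrank ℝ V / 2)
    (hpq : Module.finrank ℝ V / 2 < p + q) {x : V} (hx : x ≠ 0) :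
    ENNReal.ofReal (Gamma p * Gamma q) *
      ∫⁻ y : V, ENNReal.ofReal (‖x - y‖ ^ (-(2 * p))) * ENNReal.ofReal (‖y‖ ^ (-(2 * q))) =
      ENNReal.ofReal (π ^ (Module.finrank ℝ V / 2 : ℝ) *
        Gamma (p + q - Module.finrank ℝ V / 2) *
        (Gamma (Module.finrank ℝ V / 2 - p) * Gamma (Module.finrank ℝ V / 2 - q) /
          Gamma (Module.finrank ℝ V - p - q)) *
        ‖x‖ ^ (Module.finrank ℝ V - 2 * p - 2 * q : ℝ)) := by
  rw [← lintegral_lintegral_rpow_mul_gaussian hp hq hpq (norm_pos_iff.2 hx),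
    ← lintegral_const_mul _ (by fun_prop)]
  calc _ = ∫⁻ y : V, ∫⁻ s in Set.Ioi (0 : ℝ), ∫⁻ t in Set.Ioi (0 : ℝ),
        ENNReal.ofReal (s ^ (p - 1) * exp (-(s * ‖x - y‖ ^ 2))) *
        ENNReal.ofReal (t ^ (q - 1) * exp (-(t * ‖y‖ ^ 2))) := by
        refine lintegral_congr_ae ?_
        filter_upwards [Measure.ae_ne volume x, Measure.ae_ne volume 0] with y hyx hy0
        simp_rw [lintegral_const_mul _ (show Measurable fun t : ℝ =>
          ENNReal.ofReal (t ^ (q - 1) * exp (-(t * ‖y‖ ^ 2))) by fun_prop)]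
        rw [lintegral_mul_const _ (by fun_prop),
          ← ofReal_Gamma_mul_norm_rpow hp0 (sub_ne_zero.2 hyx.symm),
          ← ofReal_Gamma_mul_norm_rpow hq0 hy0, ENNReal.ofReal_mul (Gamma_pos_of_pos hp0).le]
        ring
    _ = ∫⁻ s in Set.Ioi (0 : ℝ), ∫⁻ y : V, ∫⁻ t in Set.Ioi (0 : ℝ),
        ENNReal.ofReal (s ^ (p - 1) * exp (-(s * ‖x - y‖ ^ 2))) *
        ENNReal.ofReal (t ^ (q - 1) * exp (-(t * ‖y‖ ^ 2))) := by
        refine lintegral_lintegral_swap (Measurable.aemeasurable ?_)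
        exact Measurable.lintegral_prod_right' (f := fun z : (V × ℝ) × ℝ =>
          ENNReal.ofReal (z.1.2 ^ (p - 1) * exp (-(z.1.2 * ‖x - z.1.1‖ ^ 2))) *
          ENNReal.ofReal (z.2 ^ (q - 1) * exp (-(z.2 * ‖z.1.1‖ ^ 2)))) (by fun_prop)
    _ = ∫⁻ s in Set.Ioi (0 : ℝ), ∫⁻ t in Set.Ioi (0 : ℝ), ∫⁻ y : V,
        ENNReal.ofReal (s ^ (p - 1) * exp (-(s * ‖x - y‖ ^ 2))) *
        ENNReal.ofReal (t ^ (q - 1) * exp (-(t * ‖y‖ ^ 2))) := by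
        refine lintegral_congr fun s => ?_
        refine lintegral_lintegral_swap (Measurable.aemeasurable ?_)
        unfold Function.uncurry
        fun_prop
    _ = _ := by
        refine setLIntegral_congr_fun measurableSet_Ioi fun s hs => ?_
        refine setLIntegral_congr_fun measurableSet_Ioi fun t ht => ?_
        have hs : 0 < s := hs
        have ht : 0 < t := ht
        rw [← lintegral_exp_neg_mul_sq_norm_sub_add x hs ht,
          ← lintegral_const_mul _ (by fun_prop)]
        refine lintegral_congr fun y => ?_
        rw [← ENNReal.ofReal_mul (by positivity), ← ENNReal.ofReal_mul (by positivity), neg_add,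
          exp_add]
        ring_nf

end InnerProductSpace

/-- The constant in the composition formula for Riesz kernels on a space of dimension `d`. -/
def rieszConst (d a b : ℝ) : ℝ :=
  π ^ (d / 2) * (Gamma (a / 2) / Gamma ((d - a) / 2)) * (Gamma (b / 2) / Gamma ((d - b) / 2)) *
    (Gamma ((d - a - b) / 2) / Gamma ((a + b) / 2))

theorem rieszConst_pos {d a b : ℝ} (ha : 0 < a) (hb : 0 < b) (hab : a + b < d) :
    0 < rieszConst d a b := by
  have h1 := Gamma_pos_of_pos (half_pos ha)
  have h2 := Gamma_pos_of_pos (half_pos hb)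
  have h3 : 0 < Gamma ((d - a) / 2) := Gamma_pos_of_pos (by linarith)
  have h4 : 0 < Gamma ((d - b) / 2) := Gamma_pos_of_pos (by linarith)
  have h5 : 0 < Gamma ((d - a - b) / 2) := Gamma_pos_of_pos (by linarith)
  have h6 : 0 < Gamma ((a + b) / 2) := Gamma_pos_of_pos (by linarith)
  unfold rieszConst
  positivity

/-- The composition formula for Riesz kernels. -/
theorem lintegral_riesz_mul_riesz {V : Type*} [NormedAddCommGroup V] [InnerProductSpace ℝ V]
    [FiniteDimensional ℝ V] [MeasurableSpace V] [BorelSpace V] {d a b : ℝ}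
    (hd : d = Module.finrank ℝ V) (ha : 0 < a) (hb : 0 < b) (hab : a + b < d)
    {x z : V} (hxz : x ≠ z) :
    ∫⁻ y : V, ENNReal.ofReal (‖x - y‖ ^ (a - d)) * ENNReal.ofReal (‖z - y‖ ^ (b - d)) =
      ENNReal.ofReal (rieszConst d a b * ‖x - z‖ ^ (a + b - d)) := by
  have : Nontrivial V := ⟨x, z, hxz⟩
  have h := lintegral_norm_sub_rpow_mul_norm_rpow (V := V) (p := (d - a) / 2) (q := (d - b) / 2)
    (by linarith) (by linarith) (by linarith) (by linarith) (by linarith) (sub_ne_zero.2 hxz)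
  rw [← hd] at h
  have hshift := lintegral_sub_right_eq_self (μ := (volume : Measure V)) (fun y : V =>
    ENNReal.ofReal (‖x - z - y‖ ^ (a - d)) * ENNReal.ofReal (‖y‖ ^ (b - d))) z
  have ea : -(2 * ((d - a) / 2)) = a - d := by ring
  have eb : -(2 * ((d - b) / 2)) = b - d := by ring
  rw [ea, eb, ← hshift] at h
  simp only [sub_sub_sub_cancel_right, norm_sub_rev _ z] at h
  have h1 : 0 < Gamma ((d - a) / 2) := Gamma_pos_of_pos (by linarith)
  have h2 : 0 < Gamma ((d - b) / 2) := Gamma_pos_of_pos (by linarith)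
  have h12 : 0 < Gamma ((d - a) / 2) * Gamma ((d - b) / 2) := mul_pos h1 h2
  rw [← ENNReal.mul_right_inj (ENNReal.ofReal_pos.2 h12).ne' ENNReal.ofReal_ne_top, h,
    ← ENNReal.ofReal_mul h12.le]
  congr 1
  rw [rieszConst, show d / 2 - (d - a) / 2 = a / 2 by ring,
    show d / 2 - (d - b) / 2 = b / 2 by ring,
    show d - (d - a) / 2 - (d - b) / 2 = (a + b) / 2 by ring,
    show (d - a) / 2 + (d - b) / 2 - d / 2 = (d - a - b) / 2 by ring,
    show d - 2 * ((d - a) / 2) - 2 * ((d - b) / 2) = a + b - d by ring, norm_sub_rev z x]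
  field_simp

theorem lintegral_fin_prod_eq_prod {X : Type*} [MeasureSpace X]
    [SigmaFinite (volume : Measure X)] {m : ℕ} (g : Fin m → X → ℝ≥0∞)
    (hg : ∀ k, Measurable (g k)) :
    ∫⁻ y : Fin m → X, ∏ k, g k (y k) = ∏ k, ∫⁻ t, g k t := by
  induction m with
  | zero => simp [volume_pi]
  | succ m ih =>
    have hmp := (volume_preserving_piFinSuccAbove (fun _ : Fin (m + 1) => X) 0).symm
    rw [← hmp.lintegral_comp_emb (MeasurableEquiv.measurableEmbedding _)]
    simp only [Fin.prod_univ_succ]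
    rw [← ih _ fun k => hg k.succ, ← lintegral_prod_mul (hg 0).aemeasurable
      (Finset.measurable_prod _ fun k _ => by fun_prop).aemeasurable]
    rfl

theorem sq_lintegral_mul_le {Y : Type*} [MeasurableSpace Y] (ν : Measure Y) {u v : Y → ℝ≥0∞}
    (hu : AEMeasurable u ν) (hv : AEMeasurable v ν) :
    (∫⁻ y, u y * v y ∂ν) ^ 2 ≤ (∫⁻ y, u y ^ 2 ∂ν) * ∫⁻ y, v y ^ 2 ∂ν := by
  have h := ENNReal.lintegral_mul_le_Lp_mul_Lq ν HolderConjugate.two_two hu hv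
  simp only [ENNReal.rpow_two, Pi.mul_apply] at h
  calc _ ≤ _ := pow_le_pow_left' h 2
    _ = _ := by
      rw [mul_pow, ← ENNReal.rpow_two, ← ENNReal.rpow_two, ← ENNReal.rpow_mul,
        ← ENNReal.rpow_mul]
      norm_num

/-- A Schur test for a kernel `k`, with the test function on `Y` obtained by integrating
the test function `φ` on `X` against the kernel. -/
theorem lintegral_mul_sq_lintegral_le_of_schur {X Y : Type*} [MeasurableSpace X]
    [MeasurableSpace Y] {μ : Measure X} {ν : Measure Y} [SFinite μ] [SFinite ν]
    {k : X → Y → ℝ≥0∞} (hk : Measurable (Function.uncurry k)) {φ w C : X → ℝ≥0∞}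
    (hφ : Measurable φ) {D : ℝ≥0∞}
    (hpos : ∀ᵐ y ∂ν, ∫⁻ z, φ z * k z y ∂μ ≠ 0)
    (hC : ∀ᵐ x ∂μ, C x ≠ ∞ ∧ ∫⁻ y, k x y * ∫⁻ z, φ z * k z y ∂μ ∂ν ≤ C x ∧ w x * C x ≤ D * φ x)
    {f : Y → ℝ≥0∞} (hf : Measurable f) :
    ∫⁻ x, w x * (∫⁻ y, k x y * f y ∂ν) ^ 2 ∂μ ≤ D * ∫⁻ y, f y ^ 2 ∂ν := by
  set h : Y → ℝ≥0∞ := fun y => ∫⁻ z, φ z * k z y ∂μ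
  have hkx : ∀ x, Measurable (k x) := fun x => hk.comp measurable_prodMk_left
  have hmeas : Measurable h :=
    Measurable.lintegral_prod_left (f := fun z y => φ z * k z y)
      ((hφ.comp measurable_fst).mul hk)
  have hpoint : ∀ᵐ x ∂μ, w x * (∫⁻ y, k x y * f y ∂ν) ^ 2 ≤
      ∫⁻ y, D * (φ x * k x y * (f y ^ 2 / h y)) ∂ν := by
    filter_upwards [hC] with x ⟨hfin, hle, hwC⟩
    have hlt : ∀ᵐ y ∂ν, k x y * h y < ∞ :=
      ae_lt_top ((hkx x).mul hmeas) (hle.trans_lt hfin.lt_top).ne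
    have hcs := sq_lintegral_mul_le ν
      (u := fun y => (k x y * (f y ^ 2 / h y)) ^ (1 / 2 : ℝ))
      (v := fun y => (k x y * h y) ^ (1 / 2 : ℝ))
      (by fun_prop) (by fun_prop)
    have hsq : ∀ a : ℝ≥0∞, (a ^ (1 / 2 : ℝ)) ^ 2 = a := fun a => by
      rw [← ENNReal.rpow_two, ← ENNReal.rpow_mul]; norm_num
    have hsqrt : ∀ a : ℝ≥0∞, (a ^ 2) ^ (1 / 2 : ℝ) = a := fun a => by
      rw [← ENNReal.rpow_two, ← ENNReal.rpow_mul]; norm_num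
    have hprod : ∫⁻ y, k x y * f y ∂ν = ∫⁻ y, (k x y * (f y ^ 2 / h y)) ^ (1 / 2 : ℝ) *
        (k x y * h y) ^ (1 / 2 : ℝ) ∂ν := by
      refine lintegral_congr_ae ?_
      filter_upwards [hlt, hpos] with y hy hy0
      rw [← ENNReal.mul_rpow_of_nonneg _ _ (by norm_num : (0 : ℝ) ≤ 1 / 2)]
      by_cases hk0 : k x y = 0
      · simp [hk0]
      have hytop : h y ≠ ∞ := fun htop => by
        rw [htop, ENNReal.mul_top hk0] at hy
        exact hy.ne rfl
      rw [show k x y * (f y ^ 2 / h y) * (k x y * h y) =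
        k x y ^ 2 * (f y ^ 2 / h y * h y) by ring, ENNReal.div_mul_cancel hy0 hytop, ← mul_pow,
        hsqrt]
    simp only [hsq] at hcs
    rw [← hprod] at hcs
    calc w x * (∫⁻ y, k x y * f y ∂ν) ^ 2
        ≤ w x * ((∫⁻ y, k x y * (f y ^ 2 / h y) ∂ν) * C x) := by
          gcongr
          exact hcs.trans (by gcongr)
      _ = (w x * C x) * ∫⁻ y, k x y * (f y ^ 2 / h y) ∂ν := by ring
      _ ≤ (D * φ x) * ∫⁻ y, k x y * (f y ^ 2 / h y) ∂ν := by gcongr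
      _ = ∫⁻ y, D * (φ x * k x y * (f y ^ 2 / h y)) ∂ν := by
        rw [← lintegral_const_mul _ (by fun_prop)]
        refine lintegral_congr fun y => ?_
        ring
  have hg : Measurable fun y => f y ^ 2 / h y := (hf.pow_const 2).div hmeas
  have huncurry : Measurable fun z : X × Y => φ z.1 * k z.1 z.2 * (f z.2 ^ 2 / h z.2) :=
    ((hφ.comp measurable_fst).mul hk).mul (hg.comp measurable_snd)
  calc _ ≤ ∫⁻ x, ∫⁻ y, D * (φ x * k x y * (f y ^ 2 / h y)) ∂ν ∂μ := lintegral_mono_ae hpoint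
    _ = ∫⁻ y, ∫⁻ x, D * (φ x * k x y * (f y ^ 2 / h y)) ∂μ ∂ν :=
      lintegral_lintegral_swap (huncurry.const_mul D).aemeasurable
    _ = ∫⁻ y, D * (h y * (f y ^ 2 / h y)) ∂ν := by
      refine lintegral_congr fun y => ?_
      have hky : Measurable fun x => k x y := hk.comp measurable_prodMk_right
      rw [lintegral_const_mul _ (by fun_prop), lintegral_mul_const _ (by fun_prop)]
    _ ≤ ∫⁻ y, D * f y ^ 2 ∂ν := by
      gcongr
      exact ENNReal.mul_div_le
    _ = _ := lintegral_const_mul _ (hf.pow_const 2)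

/-- The iterated kernel of the weighted multilinear fractional integral, applied to the critical
power `‖z‖ ^ (-(n + β) / 2)`. -/
theorem lintegral_multilinear_kernel_eq {m n : ℕ} (hn : 1 ≤ n) {α : Fin m → ℝ}
    (hα : ∀ k, 0 < α k ∧ α k < n) {β : ℝ} (hβ : β = (∑ k, α k) - ((m : ℝ) - 1) * n)
    (hβ0 : 0 < β) (hβn : β < n) {x : EuclideanSpace ℝ (Fin n)} (hx : x ≠ 0) :
    ∫⁻ y : Fin m → EuclideanSpace ℝ (Fin n),
      (∏ k, ENNReal.ofReal (‖x - y k‖ ^ (α k / 2 - n))) *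
        ∫⁻ z : EuclideanSpace ℝ (Fin n), ENNReal.ofReal (‖z‖ ^ ((n - β) / 2 - n)) *
          ∏ k, ENNReal.ofReal (‖z - y k‖ ^ (α k / 2 - n)) =
      ENNReal.ofReal ((∏ k, rieszConst n (α k / 2) (α k / 2)) *
        (rieszConst n β ((n - β) / 2) * ‖x‖ ^ (β + (n - β) / 2 - n))) := by
  have : Nonempty (Fin n) := ⟨⟨0, hn⟩⟩
  have hd : (n : ℝ) = Module.finrank ℝ (EuclideanSpace ℝ (Fin n)) := by simp
  have hc : ∀ k, 0 < rieszConst n (α k / 2) (α k / 2) := fun k => by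
    have := hα k
    exact rieszConst_pos (by linarith) (by linarith) (by linarith)
  have hA0 : 0 ≤ ∏ k, rieszConst n (α k / 2) (α k / 2) :=
    Finset.prod_nonneg fun k _ => (hc k).le
  have hsum : ∑ k, (α k / 2 + α k / 2 - n) = β - n := by
    simp only [add_halves, Finset.sum_sub_distrib, Finset.sum_const, Finset.card_univ,
      Fintype.card_fin, nsmul_eq_mul, hβ]
    ring
  calc _ = ∫⁻ y : Fin m → EuclideanSpace ℝ (Fin n), ∫⁻ z : EuclideanSpace ℝ (Fin n),
        ENNReal.ofReal (‖z‖ ^ ((n - β) / 2 - n)) *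
          ∏ k, (ENNReal.ofReal (‖x - y k‖ ^ (α k / 2 - n)) *
            ENNReal.ofReal (‖z - y k‖ ^ (α k / 2 - n))) := by
        refine lintegral_congr fun y => ?_
        rw [← lintegral_const_mul _ (by fun_prop)]
        refine lintegral_congr fun z => ?_
        rw [Finset.prod_mul_distrib]
        ring
    _ = ∫⁻ z : EuclideanSpace ℝ (Fin n), ∫⁻ y : Fin m → EuclideanSpace ℝ (Fin n),
        ENNReal.ofReal (‖z‖ ^ ((n - β) / 2 - n)) *
          ∏ k, (ENNReal.ofReal (‖x - y k‖ ^ (α k / 2 - n)) *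
            ENNReal.ofReal (‖z - y k‖ ^ (α k / 2 - n))) := by
        refine lintegral_lintegral_swap (Measurable.aemeasurable ?_)
        unfold Function.uncurry
        fun_prop
    _ = ∫⁻ z : EuclideanSpace ℝ (Fin n),
        ENNReal.ofReal (∏ k, rieszConst n (α k / 2) (α k / 2)) *
          (ENNReal.ofReal (‖x - z‖ ^ (β - n)) *
            ENNReal.ofReal (‖0 - z‖ ^ ((n - β) / 2 - n))) := by
        refine lintegral_congr_ae ?_
        filter_upwards [Measure.ae_ne volume x] with z hz
        rw [lintegral_const_mul _ (by fun_prop),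
          lintegral_fin_prod_eq_prod (fun k t => ENNReal.ofReal (‖x - t‖ ^ (α k / 2 - n)) *
            ENNReal.ofReal (‖z - t‖ ^ (α k / 2 - n))) fun k => by fun_prop]
        have hk : ∀ k, ∫⁻ t, ENNReal.ofReal (‖x - t‖ ^ (α k / 2 - n)) *
            ENNReal.ofReal (‖z - t‖ ^ (α k / 2 - n)) =
            ENNReal.ofReal (rieszConst n (α k / 2) (α k / 2) *
              ‖x - z‖ ^ (α k / 2 + α k / 2 - n)) := fun k => by
          have := hα k
          exact lintegral_riesz_mul_riesz hd (by linarith) (by linarith) (by linarith) hz.symm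
        have hxz : 0 < ‖x - z‖ := norm_pos_iff.2 (sub_ne_zero.2 hz.symm)
        simp_rw [hk]
        rw [← ENNReal.ofReal_prod_of_nonneg fun k _ =>
            mul_nonneg (hc k).le (rpow_nonneg (norm_nonneg _) _),
          Finset.prod_mul_distrib, ← rpow_sum_of_pos hxz, hsum, ENNReal.ofReal_mul hA0,
          zero_sub, norm_neg]
        ring
    _ = _ := by
        rw [lintegral_const_mul _ (by fun_prop),
          lintegral_riesz_mul_riesz hd hβ0 (by linarith) (by linarith) hx,
          ← ENNReal.ofReal_mul hA0, sub_zero]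

/-- The constant of the weighted inequality in terms of Riesz composition constants. -/
theorem pitt_const_eq {m n : ℕ} (α : Fin m → ℝ) (β : ℝ) :
    π ^ (((m : ℝ) + 1) * n / 2) *
      (∏ k, Gamma (α k / 4) ^ 2 * Gamma (((n : ℝ) - α k) / 2) /
        (Gamma ((2 * (n : ℝ) - α k) / 4) ^ 2 * Gamma (α k / 2))) *
      (Gamma (β / 2) / Gamma (((n : ℝ) - β) / 2)) *
      (Gamma (((n : ℝ) - β) / 4) / Gamma (((n : ℝ) + β) / 4)) ^ 2 =
    (∏ k, rieszConst n (α k / 2) (α k / 2)) * rieszConst n β ((n - β) / 2) := by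
  have hAk : ∏ k, rieszConst n (α k / 2) (α k / 2) = (π ^ ((n : ℝ) / 2)) ^ m *
      ∏ k, Gamma (α k / 4) ^ 2 * Gamma (((n : ℝ) - α k) / 2) /
        (Gamma ((2 * (n : ℝ) - α k) / 4) ^ 2 * Gamma (α k / 2)) := by
    calc _ = ∏ k, π ^ ((n : ℝ) / 2) * (Gamma (α k / 4) ^ 2 * Gamma (((n : ℝ) - α k) / 2) /
        (Gamma ((2 * (n : ℝ) - α k) / 4) ^ 2 * Gamma (α k / 2))) := by
          refine Finset.prod_congr rfl fun k _ => ?_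
          rw [rieszConst, show α k / 2 / 2 = α k / 4 by ring,
            show ((n : ℝ) - α k / 2) / 2 = (2 * n - α k) / 4 by ring,
            show (n : ℝ) - α k / 2 - α k / 2 = n - α k by ring, add_halves]
          ring
      _ = _ := by rw [Finset.prod_mul_distrib]; simp
  have hpi : π ^ (((m : ℝ) + 1) * n / 2) = (π ^ ((n : ℝ) / 2)) ^ m * π ^ ((n : ℝ) / 2) := by
    rw [← rpow_natCast, ← rpow_mul pi_pos.le, ← rpow_add pi_pos]
    ring_nf
  rw [hAk, hpi, rieszConst, show ((n : ℝ) - β) / 2 / 2 = (n - β) / 4 by ring,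
    show ((n : ℝ) - (n - β) / 2) / 2 = (n + β) / 4 by ring,
    show ((n : ℝ) - β - (n - β) / 2) / 2 = (n - β) / 4 by ring,
    show (β + ((n : ℝ) - β) / 2) / 2 = (n + β) / 4 by ring]
  ring

/-- **Weighted multilinear fractional integral form of the Pitt inequality.**
For `0 < α_k < n`, `(m−1)n < α = Σ α_k < mn`, `β = α − (m−1)n`,
and nonnegative measurable `f` on `(ℝ^n)^m`,
`∫ |x|^{−β} (∫ Π_k |x−y_k|^{−(n−α_k/2)} f(y) dy)² dx ≤ D_β ∫ f²`. -/
theorem stmt6 (m n : ℕ) (hm : 1 ≤ m) (hn : 1 ≤ n)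
    (α : Fin m → ℝ) (hα : ∀ k, 0 < α k ∧ α k < n)
    (hlow : ((m : ℝ) - 1) * n < ∑ k, α k) (hhigh : (∑ k, α k) < m * n)
    (β : ℝ) (hβ : β = (∑ k, α k) - ((m : ℝ) - 1) * n)
    (f : (Fin m → EuclideanSpace ℝ (Fin n)) → ℝ)
    (hf : Measurable f) (hf0 : ∀ y, 0 ≤ f y) :
    (∫⁻ x : EuclideanSpace ℝ (Fin n), ENNReal.ofReal (‖x‖ ^ (-β)) *
        (∫⁻ y, (∏ k, ENNReal.ofReal (‖x - y k‖ ^ (α k / 2 - n))) *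
          ENNReal.ofReal (f y)) ^ (2 : ℕ)) ≤
      ENNReal.ofReal
        (Real.pi ^ (((m : ℝ) + 1) * n / 2) *
          (∏ k, Real.Gamma (α k / 4) ^ 2 * Real.Gamma (((n : ℝ) - α k) / 2) /
            (Real.Gamma ((2 * (n : ℝ) - α k) / 4) ^ 2 * Real.Gamma (α k / 2))) *
          (Real.Gamma (β / 2) / Real.Gamma (((n : ℝ) - β) / 2)) *
          (Real.Gamma (((n : ℝ) - β) / 4) / Real.Gamma (((n : ℝ) + β) / 4)) ^ 2) *
        ∫⁻ y, ENNReal.ofReal (f y) ^ (2 : ℕ) := by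
  have hβ0 : 0 < β := by linarith
  have hβn : β < n := by linarith
  have : Nonempty (Fin n) := ⟨⟨0, hn⟩⟩
  have hA0 : 0 < ∏ k, rieszConst n (α k / 2) (α k / 2) := Finset.prod_pos fun k _ => by
    have := hα k
    exact rieszConst_pos (by linarith) (by linarith) (by linarith)
  have hB0 : 0 < rieszConst n β ((n - β) / 2) :=
    rieszConst_pos hβ0 (by linarith) (by linarith)
  rw [pitt_const_eq]
  refine lintegral_mul_sq_lintegral_le_of_schur
    (k := fun (x : EuclideanSpace ℝ (Fin n)) (y : Fin m → EuclideanSpace ℝ (Fin n)) =>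
      ∏ k, ENNReal.ofReal (‖x - y k‖ ^ (α k / 2 - n)))
    (φ := fun z => ENNReal.ofReal (‖z‖ ^ ((n - β) / 2 - n)))
    (w := fun x => ENNReal.ofReal (‖x‖ ^ (-β)))
    (C := fun x => ENNReal.ofReal ((∏ k, rieszConst n (α k / 2) (α k / 2)) *
      (rieszConst n β ((n - β) / 2) * ‖x‖ ^ (β + (n - β) / 2 - n))))
    (f := fun y => ENNReal.ofReal (f y)) ?_ (by fun_prop) ?_ ?_ hf.ennreal_ofReal
  · unfold Function.uncurry
    fun_prop
  · refine Filter.Eventually.of_forall fun y => ?_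
    rw [Ne, lintegral_eq_zero_iff (by fun_prop)]
    intro h0
    have hne : ∀ᵐ z : EuclideanSpace ℝ (Fin n), ∀ k, z ≠ y k :=
      ae_all_iff.2 fun k => Measure.ae_ne volume (y k)
    obtain ⟨z, hz0, hz, hzero⟩ :=
      ((Measure.ae_ne volume (0 : EuclideanSpace ℝ (Fin n))).and (hne.and h0)).exists
    refine mul_ne_zero ?_ (Finset.prod_ne_zero_iff.2 fun k _ => ?_) hzero
    · exact (ENNReal.ofReal_pos.2 (rpow_pos_of_pos (norm_pos_iff.2 hz0) _)).ne'
    · exact (ENNReal.ofReal_pos.2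
        (rpow_pos_of_pos (norm_pos_iff.2 (sub_ne_zero.2 (hz k))) _)).ne'
  · filter_upwards [Measure.ae_ne volume (0 : EuclideanSpace ℝ (Fin n))] with x hx
    refine ⟨ENNReal.ofReal_ne_top, le_of_eq ?_, le_of_eq ?_⟩
    · exact lintegral_multilinear_kernel_eq hn hα hβ hβ0 hβn hx
    · have hx : 0 < ‖x‖ := norm_pos_iff.2 hx
      rw [← ENNReal.ofReal_mul (by positivity), ← ENNReal.ofReal_mul (by positivity),
        show β + ((n : ℝ) - β) / 2 - n = ((n - β) / 2 - n) + β by ring, rpow_add hx,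
        rpow_neg hx.le]
      congr 1
      field_simp
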